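/- arXiv:2307.13162 — 3 statements merged into one kernel-verified Lean document; each statement's English description precedes it below -/
import Mathlib

section
/- On an undirected graph, for every vertex t, the degree-weighted sum of the Personalized PageRank vector of t equals n times the PageRank of t: ∑_{s∈V} (d_t/d_s)·π_t(s) = n·π(t). -/
open Matrix Finset

noncomputable def transP {V : Type*} [Fintype V] [DecidableEq V]
    (G : SimpleGraph V) [DecidableRel G.Adj] : Matrix V V ℝ :=
  G.adjMatrix ℝ * (Matrix.diagonal fun u : V => (G.degree u : ℝ))⁻¹

noncomputable def pagerank {V : Type*} [Fintype V] [DecidableEq V]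
    (G : SimpleGraph V) [DecidableRel G.Adj] (α : ℝ) : V → ℝ :=
  ∑' i : ℕ, (α * (1 - α) ^ i) • ((transP G ^ i) *ᵥ fun _ : V => 1 / (Fintype.card V : ℝ))

noncomputable def pprHop {V : Type*} [Fintype V] [DecidableEq V]
    (G : SimpleGraph V) [DecidableRel G.Adj] (α : ℝ) (s : V) (ℓ : ℕ) : V → ℝ :=
  (α * (1 - α) ^ ℓ) • ((transP G ^ ℓ) *ᵥ Pi.single s 1)

noncomputable def ppr {V : Type*} [Fintype V] [DecidableEq V]
    (G : SimpleGraph V) [DecidableRel G.Adj] (α : ℝ) (s : V) : V → ℝ :=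
  ∑' ℓ : ℕ, pprHop G α s ℓ

theorem transP_apply {V : Type*} [Fintype V] [DecidableEq V]
    (G : SimpleGraph V) [DecidableRel G.Adj] (hdeg : ∀ u : V, 1 ≤ G.degree u) (i j : V) :
    transP G i j = G.adjMatrix ℝ i j * (G.degree j : ℝ)⁻¹ := by
  have hinv : (Matrix.diagonal fun u : V => (G.degree u : ℝ))⁻¹ =
      Matrix.diagonal fun u : V => (G.degree u : ℝ)⁻¹ := by
    refine Matrix.inv_eq_right_inv ?_
    rw [Matrix.diagonal_mul_diagonal, ← Matrix.diagonal_one]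
    congr 1
    ext u
    have := hdeg u
    exact mul_inv_cancel₀ (by positivity)
  rw [transP, hinv, Matrix.mul_diagonal]

theorem transP_mul_diagonal_degree {V : Type*} [Fintype V] [DecidableEq V]
    (G : SimpleGraph V) [DecidableRel G.Adj] (hdeg : ∀ u : V, 1 ≤ G.degree u) :
    transP G * Matrix.diagonal (fun u : V => (G.degree u : ℝ)) =
      Matrix.diagonal (fun u : V => (G.degree u : ℝ)) * (transP G)ᵀ := by
  ext i j
  have hi : (G.degree i : ℝ) ≠ 0 := by have := hdeg i; positivity
  have hj : (G.degree j : ℝ) ≠ 0 := by have := hdeg j; positivity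
  rw [Matrix.mul_diagonal, Matrix.diagonal_mul, Matrix.transpose_apply,
    transP_apply G hdeg, transP_apply G hdeg, ← (G.isSymm_adjMatrix (α := ℝ)).apply i j]
  field_simp

theorem transP_pow_reversible {V : Type*} [Fintype V] [DecidableEq V]
    (G : SimpleGraph V) [DecidableRel G.Adj] (hdeg : ∀ u : V, 1 ≤ G.degree u)
    (k : ℕ) (i j : V) :
    (transP G ^ k) i j * G.degree j = G.degree i * (transP G ^ k) j i := by
  have h : SemiconjBy (Matrix.diagonal (fun u : V => (G.degree u : ℝ)))
      (transP G)ᵀ (transP G) := (transP_mul_diagonal_degree G hdeg).symm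
  have hk := congrFun (congrFun (h.pow_right k).eq i) j
  rw [← Matrix.transpose_pow, Matrix.mul_diagonal, Matrix.diagonal_mul,
    Matrix.transpose_apply] at hk
  exact hk.symm

theorem transP_pow_nonneg {V : Type*} [Fintype V] [DecidableEq V]
    (G : SimpleGraph V) [DecidableRel G.Adj] (hdeg : ∀ u : V, 1 ≤ G.degree u)
    (k : ℕ) (i j : V) : 0 ≤ (transP G ^ k) i j := by
  induction k generalizing i j with
  | zero => rw [pow_zero, Matrix.one_apply]; split_ifs <;> norm_num
  | succ k ih =>
    rw [pow_succ, Matrix.mul_apply]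
    refine Finset.sum_nonneg fun l _ => mul_nonneg (ih i l) ?_
    rw [transP_apply G hdeg, SimpleGraph.adjMatrix_apply]
    split_ifs <;> positivity

theorem sum_transP_pow {V : Type*} [Fintype V] [DecidableEq V]
    (G : SimpleGraph V) [DecidableRel G.Adj] (hdeg : ∀ u : V, 1 ≤ G.degree u)
    (k : ℕ) (j : V) : ∑ i, (transP G ^ k) i j = 1 := by
  induction k generalizing j with
  | zero => simp [Matrix.one_apply]
  | succ k ih =>
    simp_rw [pow_succ, Matrix.mul_apply]
    rw [Finset.sum_comm]
    simp_rw [← Finset.sum_mul, ih, one_mul, transP_apply G hdeg]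
    have hj : (G.degree j : ℝ) ≠ 0 := by have := hdeg j; positivity
    have hcol : ∑ i, G.adjMatrix ℝ i j = G.degree j := by
      simp [SimpleGraph.adjMatrix_apply, G.adj_comm _ j, ← SimpleGraph.card_neighborFinset_eq_degree,
        SimpleGraph.neighborFinset_eq_filter]
    rw [← Finset.sum_mul, hcol, mul_inv_cancel₀ hj]

theorem summable_transP_pow {V : Type*} [Fintype V] [DecidableEq V]
    (G : SimpleGraph V) [DecidableRel G.Adj] (hdeg : ∀ u : V, 1 ≤ G.degree u)
    {α : ℝ} (hα0 : 0 < α) (hα1 : α < 1) (i j : V) :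
    Summable fun k : ℕ => α * (1 - α) ^ k * (transP G ^ k) i j := by
  have hα : 0 ≤ 1 - α := by linarith
  refine Summable.of_nonneg_of_le
    (fun k => mul_nonneg (by positivity) (transP_pow_nonneg G hdeg k i j)) (fun k => ?_)
    ((summable_geometric_of_lt_one hα (by linarith)).mul_left α)
  refine mul_le_of_le_one_right (by positivity) ?_
  rw [← sum_transP_pow G hdeg k j]
  exact Finset.single_le_sum (f := fun i => (transP G ^ k) i j)
    (fun i _ => transP_pow_nonneg G hdeg k i j) (Finset.mem_univ i)

theorem ppr_apply {V : Type*} [Fintype V] [DecidableEq V]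
    (G : SimpleGraph V) [DecidableRel G.Adj] (hdeg : ∀ u : V, 1 ≤ G.degree u)
    {α : ℝ} (hα0 : 0 < α) (hα1 : α < 1) (s t : V) :
    ppr G α s t = ∑' k : ℕ, α * (1 - α) ^ k * (transP G ^ k) t s := by
  have h : ∀ k v, pprHop G α s k v = α * (1 - α) ^ k * (transP G ^ k) v s := fun k v => by
    simp [pprHop]
  have hs : Summable (pprHop G α s) := Pi.summable.2 fun v => by
    simpa only [h] using summable_transP_pow G hdeg hα0 hα1 v s
  rw [ppr, tsum_apply hs]
  simp_rw [h]

theorem card_mul_pagerank_apply {V : Type*} [Fintype V] [DecidableEq V] [Nonempty V]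
    (G : SimpleGraph V) [DecidableRel G.Adj] (hdeg : ∀ u : V, 1 ≤ G.degree u)
    {α : ℝ} (hα0 : 0 < α) (hα1 : α < 1) (t : V) :
    (Fintype.card V : ℝ) * pagerank G α t = ∑ s, ppr G α s t := by
  have h : ∀ (k : ℕ) v, ((α * (1 - α) ^ k) •
      ((transP G ^ k) *ᵥ fun _ : V => 1 / (Fintype.card V : ℝ))) v =
      (∑ s, α * (1 - α) ^ k * (transP G ^ k) v s) * (Fintype.card V : ℝ)⁻¹ := fun k v => by
    simp [Matrix.mulVec, dotProduct, ← Finset.sum_mul, ← Finset.mul_sum, mul_assoc]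
  have hsum : ∀ v, Summable fun k : ℕ => ∑ s, α * (1 - α) ^ k * (transP G ^ k) v s := fun v =>
    summable_sum fun s _ => summable_transP_pow G hdeg hα0 hα1 v s
  have hs : Summable fun k : ℕ => (α * (1 - α) ^ k) •
      ((transP G ^ k) *ᵥ fun _ : V => 1 / (Fintype.card V : ℝ)) := Pi.summable.2 fun v => by
    simpa only [h] using (hsum v).mul_right _
  rw [pagerank, tsum_apply hs]
  simp_rw [h, ppr_apply G hdeg hα0 hα1]
  rw [tsum_mul_right, Summable.tsum_finsetSum fun s _ => summable_transP_pow G hdeg hα0 hα1 t s]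
  field_simp

theorem degree_weighted_ppr_sum
    {V : Type*} [Fintype V] [DecidableEq V] [Nonempty V]
    (G : SimpleGraph V) [DecidableRel G.Adj]
    (hdeg : ∀ u : V, 1 ≤ G.degree u)
    (α : ℝ) (hα0 : 0 < α) (hα1 : α < 1) (t : V) :
    ∑ s : V, ((G.degree t : ℝ) / (G.degree s : ℝ)) * ppr G α t s =
      (Fintype.card V : ℝ) * pagerank G α t := by
  rw [card_mul_pagerank_apply G hdeg hα0 hα1]
  refine Finset.sum_congr rfl fun s _ => ?_
  rw [ppr_apply G hdeg hα0 hα1, ppr_apply G hdeg hα0 hα1, ← tsum_mul_left]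
  refine tsum_congr fun k => ?_
  have hs : (G.degree s : ℝ) ≠ 0 := by have := hdeg s; positivity
  have hrev := transP_pow_reversible G hdeg k s t
  field_simp
  linear_combination (1 - α) ^ k * hrev
end

section
/- For every vertex t of a finite undirected simple graph in which every vertex has degree at least one, the reciprocal degrees of the neighbors of t satisfy ∑_{u∈N(t)} 1/d_u ≥ d_t²/(2m), where m is the number of edges of the graph. -/
open Finset

theorem neighbor_recip_degree_sum
    {V : Type*} [Fintype V] [DecidableEq V] [Nonempty V]
    (G : SimpleGraph V) [DecidableRel G.Adj]
    (hdeg : ∀ u : V, 1 ≤ G.degree u) (t : V) :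
    ((G.degree t : ℝ)) ^ 2 / (2 * (G.edgeFinset.card : ℝ)) ≤
      ∑ u ∈ G.neighborFinset t, 1 / (G.degree u : ℝ) := by
  have hpos (u : V) : (0 : ℝ) < G.degree u := by exact_mod_cast hdeg u
  have hne : (G.neighborFinset t).Nonempty :=
    card_pos.mp (by rw [G.card_neighborFinset_eq_degree]; exact hdeg t)
  have htotal : ∑ u, (G.degree u : ℝ) = 2 * (#G.edgeFinset : ℝ) := by
    exact_mod_cast G.sum_degrees_eq_twice_card_edges
  have hle : ∑ u ∈ G.neighborFinset t, (G.degree u : ℝ) ≤ 2 * (#G.edgeFinset : ℝ) :=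
    htotal ▸ sum_le_univ_sum_of_nonneg fun u => (hpos u).le
  calc (G.degree t : ℝ) ^ 2 / (2 * (#G.edgeFinset : ℝ))
      ≤ (G.degree t : ℝ) ^ 2 / ∑ u ∈ G.neighborFinset t, (G.degree u : ℝ) :=
        div_le_div_of_nonneg_left (sq_nonneg _) (sum_pos (fun u _ => hpos u) hne) hle
    _ ≤ ∑ u ∈ G.neighborFinset t, 1 / (G.degree u : ℝ) := by
        simpa using sq_sum_div_le_sum_sq_div (G.neighborFinset t) (fun _ => (1 : ℝ))
          (fun u _ => hpos u)
end

section
/- For every vertex t, the PageRank value satisfies π(t) ≥ (α/n)·(1 + (1-α)·d_t²/(2m)). -/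
open Matrix Finset

namespace SimpleGraph

variable {V : Type*} [Fintype V] [DecidableEq V] (G : SimpleGraph V) [DecidableRel G.Adj]

theorem transP_apply (hdeg : ∀ u : V, 1 ≤ G.degree u) (u v : V) :
    transP G u v = if G.Adj u v then (G.degree v : ℝ)⁻¹ else 0 := by
  have hinv : (Matrix.diagonal fun u : V => (G.degree u : ℝ))⁻¹ =
      Matrix.diagonal fun u : V => (G.degree u : ℝ)⁻¹ := by
    refine Matrix.inv_eq_right_inv ?_
    rw [Matrix.diagonal_mul_diagonal, ← Matrix.diagonal_one]
    congr 1
    funext w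
    have := hdeg w
    exact mul_inv_cancel₀ (by positivity)
  rw [transP, hinv, Matrix.mul_diagonal, SimpleGraph.adjMatrix_apply]
  split_ifs <;> simp

theorem transP_nonneg (hdeg : ∀ u : V, 1 ≤ G.degree u) (u v : V) : 0 ≤ transP G u v := by
  rw [transP_apply G hdeg]
  split_ifs <;> positivity

theorem sum_transP_apply (hdeg : ∀ u : V, 1 ≤ G.degree u) (v : V) : ∑ u, transP G u v = 1 := by
  have := hdeg v
  simp_rw [transP_apply G hdeg, G.adj_comm _ v]
  rw [← Finset.sum_filter, ← G.neighborFinset_eq_filter, Finset.sum_const,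
    G.card_neighborFinset_eq_degree, nsmul_eq_mul, mul_inv_cancel₀ (by positivity)]

theorem transP_pow_mulVec_nonneg (hdeg : ∀ u : V, 1 ≤ G.degree u) {x : V → ℝ}
    (hx : ∀ v, 0 ≤ x v) (i : ℕ) (u : V) : 0 ≤ (transP G ^ i *ᵥ x) u := by
  induction i generalizing u with
  | zero => simpa using hx u
  | succ i ih =>
    rw [pow_succ', ← Matrix.mulVec_mulVec]
    exact Finset.sum_nonneg fun v _ => mul_nonneg (transP_nonneg G hdeg u v) (ih v)

theorem sum_transP_pow_mulVec (hdeg : ∀ u : V, 1 ≤ G.degree u) (x : V → ℝ) (i : ℕ) :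
    ∑ u, (transP G ^ i *ᵥ x) u = ∑ u, x u := by
  induction i with
  | zero => simp
  | succ i ih =>
    rw [pow_succ', ← Matrix.mulVec_mulVec, ← ih]
    simp only [Matrix.mulVec, dotProduct]
    rw [Finset.sum_comm]
    refine Finset.sum_congr rfl fun v _ => ?_
    rw [← Finset.sum_mul, sum_transP_apply G hdeg, one_mul]

theorem summable_smul_transP_pow_mulVec (hdeg : ∀ u : V, 1 ≤ G.degree u) {x : V → ℝ}
    (hx : ∀ v, 0 ≤ x v) {α : ℝ} (hα0 : 0 < α) (hα1 : α < 1) :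
    Summable fun i : ℕ => (α * (1 - α) ^ i) • (transP G ^ i *ᵥ x) := by
  have h1 : 0 ≤ 1 - α := by linarith
  refine Pi.summable.2 fun u => ?_
  refine Summable.of_nonneg_of_le (f := fun i : ℕ => α * (1 - α) ^ i * ∑ v, x v)
    (fun i => ?_) (fun i => ?_) ?_
  · exact mul_nonneg (by positivity) (transP_pow_mulVec_nonneg G hdeg hx i u)
  · rw [← sum_transP_pow_mulVec G hdeg x i]
    exact mul_le_mul_of_nonneg_left
      (Finset.single_le_sum (fun v _ => transP_pow_mulVec_nonneg G hdeg hx i v)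
        (Finset.mem_univ u)) (by positivity)
  · exact ((summable_geometric_of_lt_one h1 (by linarith)).mul_left α).mul_right _

omit [DecidableEq V] in
theorem sq_degree_div_le_sum_inv_degree (hdeg : ∀ u : V, 1 ≤ G.degree u) (t : V) :
    (G.degree t : ℝ) ^ 2 / (2 * (G.edgeFinset.card : ℝ)) ≤
      ∑ u ∈ G.neighborFinset t, (G.degree u : ℝ)⁻¹ := by
  have hpos : ∀ u, (0 : ℝ) < G.degree u := fun u => by exact_mod_cast hdeg u
  have hne : (G.neighborFinset t).Nonempty := by
    rw [← Finset.card_pos, G.card_neighborFinset_eq_degree]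
    exact hdeg t
  have hsum : ∑ u ∈ G.neighborFinset t, (G.degree u : ℝ) ≤ 2 * (G.edgeFinset.card : ℝ) := by
    have h := G.sum_degrees_eq_twice_card_edges
    calc ∑ u ∈ G.neighborFinset t, (G.degree u : ℝ) ≤ ∑ u, (G.degree u : ℝ) :=
          Finset.sum_le_sum_of_subset_of_nonneg (Finset.subset_univ _) fun u _ _ => (hpos u).le
      _ = 2 * (G.edgeFinset.card : ℝ) := by exact_mod_cast h
  have hcs := Finset.sq_sum_div_le_sum_sq_div (G.neighborFinset t) (fun _ => (1 : ℝ))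
    (g := fun u => (G.degree u : ℝ)) fun u _ => hpos u
  simp only [Finset.sum_const, G.card_neighborFinset_eq_degree, nsmul_eq_mul, mul_one, one_pow,
    one_div] at hcs
  exact (div_le_div_of_nonneg_left (sq_nonneg _)
    (Finset.sum_pos (fun u _ => hpos u) hne) hsum).trans hcs

end SimpleGraph

theorem pagerank_degree_lower_bound
    {V : Type*} [Fintype V] [DecidableEq V] [Nonempty V]
    (G : SimpleGraph V) [DecidableRel G.Adj]
    (hdeg : ∀ u : V, 1 ≤ G.degree u)
    (α : ℝ) (hα0 : 0 < α) (hα1 : α < 1) (t : V) :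
    (α / (Fintype.card V : ℝ)) *
        (1 + (1 - α) * (G.degree t : ℝ) ^ 2 / (2 * (G.edgeFinset.card : ℝ))) ≤
      pagerank G α t := by
  have hnonneg : ∀ v : V, 0 ≤ (fun _ : V => 1 / (Fintype.card V : ℝ)) v := fun _ => by positivity
  have hsummable := G.summable_smul_transP_pow_mulVec hdeg hnonneg hα0 hα1
  have h1 : 0 ≤ 1 - α := by linarith
  rw [pagerank, tsum_apply hsummable]
  refine le_trans ?_ ((Pi.summable.1 hsummable t).sum_le_tsum (Finset.range 2) fun i _ =>
    mul_nonneg (by positivity) (G.transP_pow_mulVec_nonneg hdeg hnonneg i t))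
  have hstep : (transP G *ᵥ fun _ : V => 1 / (Fintype.card V : ℝ)) t =
      (∑ u ∈ G.neighborFinset t, (G.degree u : ℝ)⁻¹) * (1 / (Fintype.card V : ℝ)) := by
    simp only [Matrix.mulVec, dotProduct]
    rw [← Finset.sum_mul, G.neighborFinset_eq_filter, Finset.sum_filter]
    simp_rw [G.transP_apply hdeg]
  simp only [Finset.sum_range_succ, Finset.sum_range_zero, zero_add, pow_zero, pow_one, mul_one,
    Matrix.one_mulVec, Pi.smul_apply, smul_eq_mul, hstep]
  calc (α / (Fintype.card V : ℝ)) *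
        (1 + (1 - α) * (G.degree t : ℝ) ^ 2 / (2 * (G.edgeFinset.card : ℝ)))
      ≤ (α / (Fintype.card V : ℝ)) *
        (1 + (1 - α) * ∑ u ∈ G.neighborFinset t, (G.degree u : ℝ)⁻¹) := by
        rw [mul_div_assoc]
        gcongr
        exact G.sq_degree_div_le_sum_inv_degree hdeg t
    _ = _ := by ring
end
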